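/- arXiv:1307.1881 — 3 statements merged into one kernel-verified Lean document; each statement's English description precedes it below -/
import Mathlib

section
/- Let j : ℝ → ℝ be a convex function. Then j(r)/|r| → ∞ as |r| → ∞ if and only if for every M > 0 there exists W_M > 0 such that whenever ω is a subgradient of j at r and |ω| ≤ M, one has |r| ≤ W_M (i.e., the inverse of the subdifferential of j maps bounded sets to bounded sets). -/
open Filter

/-- `ω` is a subgradient of `j` at `r`. -/
def IsSubgradient (j : ℝ → ℝ) (ω r : ℝ) : Prop :=
  ∀ s : ℝ, j r + ω * (s - r) ≤ j s

/-- A convex function on the real line has a subgradient at every point. -/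
lemma ConvexOn.exists_isSubgradient {j : ℝ → ℝ} (hj : ConvexOn ℝ Set.univ j) (r : ℝ) :
    ∃ ω, IsSubgradient j ω r := by
  have hr : r ∈ interior (Set.univ : Set ℝ) := by simp
  refine ⟨derivWithin j (Set.Ioi r) r, fun s => ?_⟩
  rcases lt_trichotomy s r with h | rfl | h
  · have h₁ := (hj.slope_le_leftDeriv_of_mem_interior (Set.mem_univ s) hr h).trans
      (hj.leftDeriv_le_rightDeriv_of_mem_interior hr)
    rw [slope_def_field, div_le_iff₀ (sub_pos.2 h)] at h₁
    linarith
  · simp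
  · have h₁ := hj.rightDeriv_le_slope_of_mem_interior hr (Set.mem_univ s) h
    rw [slope_def_field, le_div_iff₀ (sub_pos.2 h)] at h₁
    linarith

/-- The subdifferential is monotone. -/
lemma IsSubgradient.le_of_lt {j : ℝ → ℝ} {ω₁ ω₂ r₁ r₂ : ℝ} (h₁ : IsSubgradient j ω₁ r₁)
    (h₂ : IsSubgradient j ω₂ r₂) (h : r₁ < r₂) : ω₁ ≤ ω₂ := by
  have h₃ := h₁ r₂
  have h₄ := h₂ r₁
  nlinarith

/-- For a convex `j : ℝ → ℝ`, superlinearity `j(r)/|r| → ∞` as `|r| → ∞` is equivalent to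
the boundedness of `(∂j)⁻¹` on bounded sets: for every `M > 0` there is `W_M > 0` such that
any point `r` possessing a subgradient `ω` with `|ω| ≤ M` satisfies `|r| ≤ W_M`. -/
theorem superlinear_iff_inv_subdifferential_bounded (j : ℝ → ℝ)
    (hj : ConvexOn ℝ Set.univ j) :
    Tendsto (fun r : ℝ => j r / |r|) (cocompact ℝ) atTop ↔
      ∀ M > (0 : ℝ), ∃ W > (0 : ℝ), ∀ r ω : ℝ,
        IsSubgradient j ω r → |ω| ≤ M → |r| ≤ W := by
  rw [cocompact_eq_atBot_atTop, tendsto_sup]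
  constructor
  · rintro ⟨hbot, htop⟩ M hM
    obtain ⟨a, ha⟩ := eventually_atBot.1 (hbot.eventually_ge_atTop (M + 1))
    obtain ⟨b, hb⟩ := eventually_atTop.1 (htop.eventually_ge_atTop (M + 1))
    refine ⟨|a| + |b| + |j 0| + 1, by positivity, fun r ω hω hωM => ?_⟩
    by_contra! hr
    have hr₀ : 0 < |r| := lt_trans (by positivity) hr
    have hgrowth : M + 1 ≤ j r / |r| := by
      rcases abs_cases r with ⟨h, -⟩ | ⟨h, -⟩
      · exact hb r (by linarith [le_abs_self b, abs_nonneg a, abs_nonneg (j 0)])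
      · exact ha r (by linarith [neg_abs_le a, abs_nonneg b, abs_nonneg (j 0)])
    rw [le_div_iff₀ hr₀] at hgrowth
    have hmul : ω * r ≤ M * |r| :=
      (le_abs_self _).trans ((abs_mul ω r).trans_le (by gcongr))
    linarith [hω 0, le_abs_self (j 0), abs_nonneg a, abs_nonneg b]
  · intro h
    obtain ⟨ω₀, hω₀⟩ := hj.exists_isSubgradient 0
    constructor <;> refine tendsto_atTop.2 fun C => ?_ <;>
      obtain ⟨W, hW, hbound⟩ := h (|ω₀| + |C| + 1) (by positivity)
    · obtain ⟨ω, hω⟩ := hj.exists_isSubgradient (-(W + 1))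
      have hle : ω ≤ ω₀ := hω.le_of_lt hω₀ (by linarith)
      have hlt : ω < -(|ω₀| + |C| + 1) := by
        by_contra! hge
        have := hbound _ _ hω (abs_le.2 ⟨hge, by linarith [le_abs_self ω₀, abs_nonneg C]⟩)
        rw [abs_neg, abs_of_pos (by linarith)] at this
        linarith
      filter_upwards [eventually_le_atBot (-(|j (-(W + 1)) + ω * (W + 1)|)),
        eventually_lt_atBot 0] with s hs hs₀
      rw [abs_of_neg hs₀, le_div_iff₀ (by linarith)]
      nlinarith [hω s, neg_abs_le (j (-(W + 1)) + ω * (W + 1)), le_abs_self C, abs_nonneg ω₀]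
    · obtain ⟨ω, hω⟩ := hj.exists_isSubgradient (W + 1)
      have hle : ω₀ ≤ ω := hω₀.le_of_lt hω (by linarith)
      have hlt : |ω₀| + |C| + 1 < ω := by
        by_contra! hge
        have := hbound _ _ hω (abs_le.2 ⟨by linarith [neg_abs_le ω₀, abs_nonneg C], hge⟩)
        rw [abs_of_pos (by linarith)] at this
        linarith
      filter_upwards [eventually_ge_atTop |j (W + 1) - ω * (W + 1)|,
        eventually_gt_atTop 0] with s hs hs₀
      rw [abs_of_pos hs₀, le_div_iff₀ hs₀]
      nlinarith [hω s, neg_abs_le (j (W + 1) - ω * (W + 1)), le_abs_self C, abs_nonneg ω₀]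
end

section
/- Let (Q, μ) be a finite measure space and let j : Q × ℝ → ℝ be such that q ↦ j(q, r) is measurable for every r ∈ ℝ and j(q, ·) is convex and continuous for a.e. q; denote by j*(q, ·) the Fenchel conjugate of j(q, ·). Assume there are constants γ₁, γ₂ ≥ 0 with j(q, −r) ≤ γ₁ j(q, r) + γ₂ for all r ∈ ℝ and a.e. q. Let y, w be measurable real-valued functions on Q such that q ↦ j(q, y(q)) and q ↦ j*(q, w(q)) belong to L¹(Q, μ). Then the product y·w belongs to L¹(Q, μ). -/
open Filter MeasureTheory

/-- The Fenchel conjugate of `j : ℝ → ℝ`, with values in `(-∞, +∞]` (as `EReal`). -/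
noncomputable def fenchelConj (j : ℝ → ℝ) (ω : ℝ) : EReal :=
  ⨆ r : ℝ, ((ω * r - j r : ℝ) : EReal)

/-- The Legendre–Fenchel inequality, when the conjugate takes a real value. -/
theorem mul_le_add_of_fenchelConj_eq {j : ℝ → ℝ} {ω c : ℝ} (h : fenchelConj j ω = (c : EReal))
    (r : ℝ) : r * ω ≤ j r + c := by
  have hle : ((ω * r - j r : ℝ) : EReal) ≤ (c : EReal) :=
    h ▸ le_iSup (fun r : ℝ => ((ω * r - j r : ℝ) : EReal)) r
  have := EReal.coe_le_coe_iff.mp hle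
  linarith

/-- First assertion of Lemma 4.1: on a finite measure space, under the symmetry condition
`j(q, −r) ≤ γ₁ j(q, r) + γ₂`, if `j(·, y(·)) ∈ L¹` and `j*(·, w(·)) ∈ L¹` (with a.e. real
value `g ∈ L¹`), then the product `y·w` is in `L¹`. -/
theorem mul_integrable_of_potentials_integrable {Q : Type*} [MeasurableSpace Q]
    (μ : Measure Q) [IsFiniteMeasure μ]
    (j : Q → ℝ → ℝ) (hmeas : ∀ r : ℝ, Measurable fun q => j q r)
    (hconv : ∀ᵐ q ∂μ, ConvexOn ℝ Set.univ (j q) ∧ Continuous (j q))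
    (γ₁ γ₂ : ℝ) (hγ₁ : 0 ≤ γ₁) (hγ₂ : 0 ≤ γ₂)
    (hsym : ∀ᵐ q ∂μ, ∀ r : ℝ, j q (-r) ≤ γ₁ * j q r + γ₂)
    (y w : Q → ℝ) (hy : AEStronglyMeasurable y μ) (hw : AEStronglyMeasurable w μ)
    (hjy : Integrable (fun q => j q (y q)) μ)
    (g : Q → ℝ) (hg : Integrable g μ)
    (hgw : ∀ᵐ q ∂μ, fenchelConj (j q) (w q) = ((g q : ℝ) : EReal)) :
    Integrable (fun q => y q * w q) μ := by
  have hbound : Integrable (fun q => (1 + γ₁) * |j q (y q)| + γ₂ + |g q|) μ :=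
    ((hjy.abs.const_mul _).add (integrable_const γ₂)).add hg.abs
  refine hbound.mono' (hy.mul hw) ?_
  filter_upwards [hsym, hgw] with q hs hq
  have h₁ := mul_le_add_of_fenchelConj_eq hq (y q)
  have h₂ := mul_le_add_of_fenchelConj_eq hq (-y q)
  have h₃ := hs (y q)
  have h₄ := le_abs_self (j q (y q))
  have h₅ := le_abs_self (g q)
  have h₆ := mul_le_mul_of_nonneg_left h₄ hγ₁
  have h₇ := mul_nonneg hγ₁ (abs_nonneg (j q (y q)))
  have h₈ := abs_nonneg (j q (y q))
  rw [Real.norm_eq_abs, abs_le]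
  constructor <;> linarith
end

section
/- Let a > 0 and define j : ℝ → ℝ by j(r) = ∫₀^{|r|} exp(a·s²) ds. Then j is convex, j(0) = 0, j(r)/|r| → ∞ as |r| → ∞, and its Fenchel conjugate satisfies j*(ω)/|ω| → ∞ as |ω| → ∞. -/
open Filter

theorem hasDerivAt_integral_exp_mul_sq (a x : ℝ) :
    HasDerivAt (fun x : ℝ => ∫ s in (0 : ℝ)..x, Real.exp (a * s ^ 2)) (Real.exp (a * x ^ 2)) x :=
  intervalIntegral.integral_hasDerivAt_right
    (Continuous.intervalIntegrable (by fun_prop) _ _)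
    (Continuous.stronglyMeasurableAtFilter (by fun_prop) _ _)
    (Continuous.continuousAt (by fun_prop))

theorem monotone_integral_exp_mul_sq (a : ℝ) :
    Monotone (fun x : ℝ => ∫ s in (0 : ℝ)..x, Real.exp (a * s ^ 2)) :=
  monotone_of_hasDerivAt_nonneg (hasDerivAt_integral_exp_mul_sq a) fun _ => (Real.exp_pos _).le

theorem convexOn_Ici_integral_exp_mul_sq {a : ℝ} (ha : 0 ≤ a) :
    ConvexOn ℝ (Set.Ici 0) (fun x : ℝ => ∫ s in (0 : ℝ)..x, Real.exp (a * s ^ 2)) := by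
  have hd : Differentiable ℝ (fun x : ℝ => ∫ s in (0 : ℝ)..x, Real.exp (a * s ^ 2)) :=
    fun x => (hasDerivAt_integral_exp_mul_sq a x).differentiableAt
  refine MonotoneOn.convexOn_of_deriv (convex_Ici 0) hd.continuous.continuousOn
    hd.differentiableOn ?_
  intro x hx y _ hxy
  rw [interior_Ici, Set.mem_Ioi] at hx
  rw [(hasDerivAt_integral_exp_mul_sq a x).deriv, (hasDerivAt_integral_exp_mul_sq a y).deriv]
  gcongr

theorem convexOn_integral_exp_mul_sq_abs {a : ℝ} (ha : 0 ≤ a) :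
    ConvexOn ℝ Set.univ (fun r : ℝ => ∫ s in (0 : ℝ)..|r|, Real.exp (a * s ^ 2)) := by
  have himg : (fun r : ℝ => |r|) '' Set.univ = Set.Ici 0 := by
    ext x
    simp only [Set.image_univ, Set.mem_range, Set.mem_Ici]
    exact ⟨fun ⟨y, hy⟩ => hy ▸ abs_nonneg y, fun hx => ⟨x, abs_of_nonneg hx⟩⟩
  refine ConvexOn.comp (g := fun x : ℝ => ∫ s in (0 : ℝ)..x, Real.exp (a * s ^ 2))
    (f := fun r : ℝ => |r|) ?_ ?_ ((monotone_integral_exp_mul_sq a).monotoneOn _)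
  · rw [himg]
    exact convexOn_Ici_integral_exp_mul_sq ha
  · exact convexOn_norm convex_univ

theorem mul_pow_three_div_le_integral_exp_mul_sq (a : ℝ) {x : ℝ} (hx : 0 ≤ x) :
    a * (x ^ 3 / 3) ≤ ∫ s in (0 : ℝ)..x, Real.exp (a * s ^ 2) := by
  calc a * (x ^ 3 / 3) = ∫ s in (0 : ℝ)..x, a * s ^ 2 := by
        rw [intervalIntegral.integral_const_mul, integral_pow]
        norm_num
    _ ≤ _ := intervalIntegral.integral_mono_on hx
        (Continuous.intervalIntegrable (by fun_prop) _ _)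
        (Continuous.intervalIntegrable (by fun_prop) _ _)
        fun s _ => by linarith [Real.add_one_le_exp (a * s ^ 2)]

theorem tendsto_integral_exp_mul_sq_div_atTop {a : ℝ} (ha : 0 < a) :
    Tendsto (fun x : ℝ => (∫ s in (0 : ℝ)..x, Real.exp (a * s ^ 2)) / x) atTop atTop := by
  have hsq : Tendsto (fun x : ℝ => a / 3 * x ^ 2) atTop atTop :=
    (tendsto_pow_atTop two_ne_zero).const_mul_atTop (by positivity)
  refine tendsto_atTop_mono' _ ?_ hsq
  filter_upwards [eventually_gt_atTop 0] with x hx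
  rw [le_div_iff₀ hx]
  linarith [mul_pow_three_div_le_integral_exp_mul_sq a hx.le]

/-- The conjugate of an even function on `ℝ` is superlinear. -/
theorem eventually_mul_abs_le_fenchelConj {j : ℝ → ℝ} (hj : ∀ r, j (-r) = j r) {M : ℝ}
    (hM : 0 < M) :
    ∃ R > (0 : ℝ), ∀ ω : ℝ, R < |ω| → ((M * |ω| : ℝ) : EReal) ≤ fenchelConj j ω := by
  refine ⟨max 1 (j (2 * M) / M), by positivity, fun ω hω => ?_⟩
  have hR : j (2 * M) < |ω| * M := (div_lt_iff₀ hM).1 ((le_max_right _ _).trans_lt hω)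
  obtain ⟨r, hr, hjr⟩ : ∃ r, ω * r = |ω| * (2 * M) ∧ j r = j (2 * M) := by
    rcases le_total 0 ω with h | h
    · exact ⟨2 * M, by rw [abs_of_nonneg h], rfl⟩
    · exact ⟨-(2 * M), by rw [abs_of_nonpos h]; ring, hj _⟩
  refine le_trans ?_ (le_iSup (fun r : ℝ => ((ω * r - j r : ℝ) : EReal)) r)
  rw [EReal.coe_le_coe_iff, hr, hjr]
  linarith

/-- The potential `j(r) = ∫₀^{|r|} exp(a·s²) ds` of `β(r) = sgn(r)·exp(a·r²)` (for `a > 0`)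
is convex, vanishes at `0`, is superlinear, and its Fenchel conjugate is superlinear:
`j*(ω)/|ω| → ∞` as `|ω| → ∞` (i.e. for every `M > 0`, `j*(ω) ≥ M·|ω|` for `|ω|` large). -/
theorem exp_potential_weakly_coercive (a : ℝ) (ha : 0 < a) :
    ConvexOn ℝ Set.univ (fun r : ℝ => ∫ s in (0 : ℝ)..|r|, Real.exp (a * s ^ 2)) ∧
    (∫ s in (0 : ℝ)..|(0 : ℝ)|, Real.exp (a * s ^ 2)) = 0 ∧
    Tendsto (fun r : ℝ => (∫ s in (0 : ℝ)..|r|, Real.exp (a * s ^ 2)) / |r|)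
      (cocompact ℝ) atTop ∧
    ∀ M > (0 : ℝ), ∃ R > (0 : ℝ), ∀ ω : ℝ, R < |ω| →
      ((M * |ω| : ℝ) : EReal) ≤
        fenchelConj (fun r : ℝ => ∫ s in (0 : ℝ)..|r|, Real.exp (a * s ^ 2)) ω := by
  refine ⟨convexOn_integral_exp_mul_sq_abs ha.le, by simp, ?_, fun M hM =>
    eventually_mul_abs_le_fenchelConj (fun r => by simp only [abs_neg]) hM⟩
  exact (tendsto_integral_exp_mul_sq_div_atTop ha).comp (tendsto_norm_cocompact_atTop (E := ℝ))
end
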